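/- Let A ∈ ℝ^{n×n} with n ≥ 2 be a P-matrix. Then every (complex) eigenvalue λ of A satisfies |arg(λ)| < π − π/n, where arg(λ) ∈ (−π, π] is the principal argument; in particular, no eigenvalue of A is real and nonpositive. -/

import Mathlib

open Matrix

/-- `A` is a P-matrix: every principal minor (over a nonempty index set) is positive. -/
def IsPMatrix {n : ℕ} (A : Matrix (Fin n) (Fin n) ℝ) : Prop :=
  ∀ α : Finset (Fin n), α.Nonempty →
    0 < (A.submatrix (Subtype.val : α → Fin n) (Subtype.val : α → Fin n)).det

/-- Negation reflects the unsigned argument of a nonzero complex number. -/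
theorem Complex.abs_arg_neg {z : ℂ} (hz : z ≠ 0) : |(-z).arg| = Real.pi - |z.arg| := by
  rw [← Complex.angle_one_left hz, ← Complex.angle_one_left (neg_ne_zero.mpr hz),
    InnerProductGeometry.angle_neg_right]

/-- A real polynomial of degree `n ≥ 2` with positive coefficients has no complex root in the
sector `|arg z| ≤ π / n`. -/
theorem Polynomial.pi_div_natDegree_lt_abs_arg {p : Polynomial ℝ} (hdeg : 2 ≤ p.natDegree)
    (hpos : ∀ k ≤ p.natDegree, 0 < p.coeff k) {z : ℂ} (hz : Polynomial.aeval z p = 0) :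
    Real.pi / p.natDegree < |z.arg| := by
  have hpolar (k : ℕ) : z ^ k = ((‖z‖ ^ k * Real.cos (k * z.arg) : ℝ) : ℂ) +
      ((‖z‖ ^ k * Real.sin (k * z.arg) : ℝ) : ℂ) * Complex.I := by
    conv_lhs => rw [← Complex.norm_mul_exp_arg_mul_I z]
    rw [mul_pow, ← Complex.exp_nat_mul, ← mul_assoc, Complex.exp_mul_I]
    push_cast
    ring
  rw [Polynomial.aeval_eq_sum_range] at hz
  have hre : ∑ k ∈ Finset.range (p.natDegree + 1),
      p.coeff k * (‖z‖ ^ k * Real.cos (k * |z.arg|)) = 0 := by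
    have h := congrArg Complex.re hz
    simp only [hpolar, Complex.re_sum, Complex.smul_re, Complex.add_re, Complex.ofReal_re,
      Complex.re_ofReal_mul, Complex.I_re, mul_zero, add_zero, Complex.zero_re, smul_eq_mul] at h
    rw [← h]
    refine Finset.sum_congr rfl fun k _ => ?_
    rcases abs_choice z.arg with h | h <;> simp [h]
  have him : ∑ k ∈ Finset.range (p.natDegree + 1),
      p.coeff k * (‖z‖ ^ k * Real.sin (k * |z.arg|)) = 0 := by
    have h := congrArg Complex.im hz
    simp only [hpolar, Complex.im_sum, Complex.smul_im, Complex.add_im, Complex.ofReal_im,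
      Complex.im_ofReal_mul, Complex.I_im, mul_one, zero_add, Complex.zero_im, smul_eq_mul] at h
    rcases abs_choice z.arg with h' | h'
    · rw [h', h]
    · simp [h', h]
  by_contra! hle
  have hn : (0 : ℝ) < p.natDegree := by exact_mod_cast (by omega : 0 < p.natDegree)
  rw [le_div_iff₀ hn] at hle
  rcases (abs_nonneg z.arg).eq_or_lt with h0 | h0
  · rw [← h0] at hre
    simp only [mul_zero, Real.cos_zero, mul_one] at hre
    refine (Finset.sum_pos' (fun k hk => ?_) ⟨0, by simp, ?_⟩).ne' hre
    · exact mul_nonneg (hpos k (Finset.mem_range_succ_iff.mp hk)).le (by positivity)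
    · simpa using hpos 0 (Nat.zero_le _)
  · have hz0 : 0 < ‖z‖ := norm_pos_iff.mpr fun h => by simp [h] at h0
    refine (Finset.sum_pos' (fun k hk => ?_) ⟨1, by simp; omega, ?_⟩).ne' him
    · have hk' := Finset.mem_range_succ_iff.mp hk
      have hkn : (k : ℝ) ≤ p.natDegree := by exact_mod_cast hk'
      have hsin : 0 ≤ Real.sin (k * |z.arg|) :=
        Real.sin_nonneg_of_nonneg_of_le_pi (by positivity) (by nlinarith)
      exact mul_nonneg (hpos k hk').le (by positivity)
    · have hn2 : (2 : ℝ) ≤ p.natDegree := by exact_mod_cast hdeg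
      have hsin : 0 < Real.sin (((1 : ℕ) : ℝ) * |z.arg|) :=
        Real.sin_pos_of_pos_of_lt_pi (by simpa using h0) (by push_cast; nlinarith)
      exact mul_pos (hpos 1 (by omega)) (by positivity)

/-- The coefficients of `det (X + A)` are positive when `A` is a P-matrix. -/
theorem IsPMatrix.coeff_charpoly_neg_pos {n : ℕ} {A : Matrix (Fin n) (Fin n) ℝ}
    (hA : IsPMatrix A) {k : ℕ} (hk : k ≤ n) : 0 < (-A).charpoly.coeff k := by
  have h := charpoly_coeff_eq_sum_minors (-A) (n - k) (by simp)
  rw [Fintype.card_fin, Nat.sub_sub_self hk, Finset.mul_sum] at h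
  rw [h]
  refine Finset.sum_pos (fun s hs => ?_) (Finset.powersetCard_nonempty.mpr (by simp))
  have hcard := (Finset.mem_powersetCard.mp hs).2
  rw [submatrix_neg, Pi.neg_apply, Pi.neg_apply, det_neg, Fintype.card_coe, hcard, ← mul_assoc,
    ← mul_pow, neg_one_mul, neg_neg, one_pow, one_mul]
  rcases s.eq_empty_or_nonempty with rfl | hs'
  · simp
  · exact hA s hs'

/-- Every complex eigenvalue `μ` of a P-matrix `A ∈ ℝ^{n×n}`, `n ≥ 2`, satisfies
`|arg μ| < π - π/n`; in particular, no eigenvalue of `A` is real and nonpositive. -/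
theorem pmatrix_eigenvalue_arg {n : ℕ} (hn : 2 ≤ n) (A : Matrix (Fin n) (Fin n) ℝ)
    (hA : IsPMatrix A) :
    ∀ μ ∈ spectrum ℂ (A.map (algebraMap ℝ ℂ)),
      |Complex.arg μ| < Real.pi - Real.pi / n ∧ ¬(μ.im = 0 ∧ μ.re ≤ 0) := by
  intro μ hμ
  have hdeg : (-A).charpoly.natDegree = n := by
    rw [charpoly_natDegree_eq_dim, Fintype.card_fin]
  have hroot : Polynomial.aeval (-μ) (-A).charpoly = 0 := by
    have hneg : -μ ∈ spectrum ℂ ((-A).map (algebraMap ℝ ℂ)) := by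
      rw [Matrix.map_neg _ (map_neg _), ← spectrum.neg_eq]
      simpa using hμ
    rwa [mem_spectrum_iff_isRoot_charpoly, charpoly_map, Polynomial.IsRoot.def,
      Polynomial.eval_map_algebraMap] at hneg
  have harg : Real.pi / n < |(-μ).arg| := by
    have h := Polynomial.pi_div_natDegree_lt_abs_arg (hdeg.symm ▸ hn)
      (fun k hk => hA.coeff_charpoly_neg_pos (hdeg ▸ hk)) hroot
    rwa [hdeg] at h
  have hpos : 0 ≤ Real.pi / n := by positivity
  constructor
  · have hμ0 : μ ≠ 0 := by
      rintro rfl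
      simp only [neg_zero, Complex.arg_zero, abs_zero] at harg
      linarith
    rw [Complex.abs_arg_neg hμ0] at harg
    linarith
  · rintro ⟨him, hre⟩
    have h0 : (-μ).arg = 0 := Complex.arg_eq_zero_iff.mpr ⟨by simpa using hre, by simpa using him⟩
    rw [h0, abs_zero] at harg
    linarith
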